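/- Suppose cov(M) = 𝔟, i.e., the least cardinality κ of a family of meagre subsets of ℝ covering ℝ equals the least cardinality of an unbounded family in ℕ → ℕ under eventual domination. Then there exists a ⊆-increasing family (A_α)_{α < κ}, indexed by the ordinals below κ, such that each A_α is a countable union of closed Lebesgue-null subsets of ℝ and ⋃_{α < κ} A_α is not Lebesgue-null. -/

import Mathlib

open MeasureTheory

/-- `cov(M)`: the least cardinality of a family of meagre subsets of `ℝ` covering `ℝ`. -/
noncomputable def covMeagre : Cardinal :=
  sInf {c : Cardinal | ∃ F : Set (Set ℝ), Cardinal.mk F = c ∧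
    (∀ S ∈ F, IsMeagre S) ∧ ⋃₀ F = Set.univ}

/-- `𝔟`: the least cardinality of a family in `ℕ → ℕ` unbounded under eventual
domination. -/
noncomputable def boundingNumber : Cardinal :=
  sInf {c : Cardinal | ∃ F : Set (ℕ → ℕ), Cardinal.mk F = c ∧
    ¬∃ g : ℕ → ℕ, ∀ f ∈ F, ∀ᶠ n in Filter.atTop, f n ≤ g n}

open Filter Set

/-- A countable union of closed Lebesgue-null sets. -/
def IsFsigmaNull (S : Set ℝ) : Prop :=
  ∃ C : ℕ → Set ℝ, (∀ n, IsClosed (C n) ∧ volume (C n) = 0) ∧ S = ⋃ n, C n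

theorem IsFsigmaNull.union {S T : Set ℝ} (hS : IsFsigmaNull S) (hT : IsFsigmaNull T) :
    IsFsigmaNull (S ∪ T) := by
  obtain ⟨C, hC, rfl⟩ := hS
  obtain ⟨D, hD, rfl⟩ := hT
  refine ⟨fun n => Sum.elim C D (Equiv.natSumNatEquivNat.symm n), fun n => ?_, ?_⟩
  · beta_reduce
    rcases Equiv.natSumNatEquivNat.symm n with k | k
    · exact hC k
    · exact hD k
  · rw [Equiv.natSumNatEquivNat.symm.surjective.iUnion_comp (Sum.elim C D), iUnion_sum]
    rfl

/-- Every `ι`-indexed family of functions in `ℕ → ℕ` is guessed infinitely often by a single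
function. -/
def GuessesInfinitelyOften (ι : Type) : Prop :=
  ∀ f : ι → ℕ → ℕ, ∃ g : ℕ → ℕ, ∀ ξ, ∃ᶠ n in atTop, f ξ n = g n

theorem exists_dense_open_reciprocal_fract (f : ℕ → ℕ) (m : ℕ) :
    ∃ D : Set ℝ, IsOpen D ∧ Dense D ∧
      ∀ x ∈ D, ∃ n ≥ m, f n = ⌊(Int.fract (n * x))⁻¹⌋₊ - 1 := by
  refine ⟨⋃ n ≥ m, ⋃ k : ℤ, (fun x : ℝ => n * x - k) ⁻¹' Ioo ((f n : ℝ) + 2)⁻¹ ((f n : ℝ) + 1)⁻¹,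
    ?_, ?_, ?_⟩
  · refine isOpen_biUnion fun n _ => isOpen_iUnion fun k => isOpen_Ioo.preimage (by fun_prop)
  · rw [Metric.dense_iff]
    intro x ε hε
    obtain ⟨n₀, hn₀⟩ := exists_nat_gt (1 / ε)
    set n := max m (n₀ + 1) with hn
    have hn1 : (1 : ℝ) ≤ n := by
      have : 1 ≤ n := by omega
      exact_mod_cast this
    have hnε : 1 / ε < n := hn₀.trans_le (by
      have : n₀ ≤ n := by omega
      exact_mod_cast this)
    have hn0 : (0 : ℝ) < n := by linarith
    set c : ℝ := ((f n : ℝ) + 3 / 2)⁻¹ with hc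
    have hf : (0 : ℝ) ≤ f n := Nat.cast_nonneg _
    have hc0 : 0 < c := by positivity
    have hc1 : c < 1 := by
      rw [hc]; exact inv_lt_one_of_one_lt₀ (by linarith)
    refine ⟨(⌊n * x⌋ + c) / n, ?_, ?_⟩
    · rw [Metric.mem_ball, Real.dist_eq]
      have h1 : (⌊n * x⌋ + c) / n - x = (⌊n * x⌋ + c - n * x) / n := by field_simp
      rw [h1, abs_div, abs_of_pos hn0, div_lt_iff₀ hn0]
      have h2 : 1 < ε * n := by
        rw [div_lt_iff₀ hε] at hnε
        linarith
      refine lt_of_le_of_lt ?_ h2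
      rw [abs_le]
      have := Int.floor_le (n * x)
      have := Int.lt_floor_add_one (n * x)
      constructor <;> linarith
    · simp only [mem_iUnion]
      refine ⟨n, le_max_left _ _, ⌊n * x⌋, ?_⟩
      have h1 : (n : ℝ) * ((⌊n * x⌋ + c) / n) - ⌊n * x⌋ = c := by field_simp; ring
      rw [mem_preimage, h1, hc]
      constructor
      · exact inv_strictAnti₀ (by linarith) (by linarith)
      · exact inv_strictAnti₀ (by linarith) (by linarith)
  · intro x hx
    simp only [mem_iUnion] at hx
    obtain ⟨n, hn, k, hk1, hk2⟩ := hx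
    refine ⟨n, hn, ?_⟩
    have hf : (0 : ℝ) ≤ f n := Nat.cast_nonneg _
    have h0 : 0 < (n : ℝ) * x - k := lt_trans (by positivity) hk1
    have h1 : (n : ℝ) * x - k < 1 := hk2.trans_le (inv_le_one_of_one_le₀ (by linarith))
    have hfr : Int.fract ((n : ℝ) * x) = n * x - k :=
      Int.fract_eq_iff.2 ⟨h0.le, h1, k, by ring⟩
    have hfl : ⌊(Int.fract ((n : ℝ) * x))⁻¹⌋₊ = f n + 1 := by
      rw [hfr, Nat.floor_eq_iff (by positivity)]
      push_cast
      constructor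
      · exact (le_inv_comm₀ (by positivity) h0).2 hk2.le
      · rw [inv_lt_comm₀ h0 (by positivity)]
        rwa [show (f n : ℝ) + 1 + 1 = f n + 2 by ring]
    rw [hfl]; rfl

theorem guessesInfinitelyOften_of_lt_covMeagre {ι : Type} (h : Cardinal.mk ι < covMeagre) :
    GuessesInfinitelyOften ι := by
  intro f
  choose D hDo hDd hD using fun ξ => exists_dense_open_reciprocal_fract (f ξ)
  by_contra hcon
  push Not at hcon
  refine absurd h (not_lt.2 ?_)
  let M : ι → Set ℝ := fun ξ => (⋂ m, D ξ m)ᶜ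
  refine le_trans (csInf_le' ⟨range M, rfl, ?_, ?_⟩) Cardinal.mk_range_le
  · rintro _ ⟨ξ, rfl⟩
    simp only [M, IsMeagre, compl_compl]
    exact countable_iInter_mem.2 fun m => residual_of_dense_open (hDo ξ m) (hDd ξ m)
  · rw [eq_univ_iff_forall]
    intro x
    obtain ⟨ξ, hξ⟩ := hcon fun n => ⌊(Int.fract (n * x))⁻¹⌋₊ - 1
    refine ⟨M ξ, ⟨ξ, rfl⟩, fun hx => ?_⟩
    obtain ⟨N, hN⟩ := eventually_atTop.1 hξ
    obtain ⟨n, hn, hfn⟩ := hD ξ N x (mem_iInter.1 hx N)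
    exact hN n hn hfn

theorem exists_bound_of_lt_boundingNumber {ι : Type} (h : Cardinal.mk ι < boundingNumber)
    (f : ι → ℕ → ℕ) : ∃ g : ℕ → ℕ, ∀ ξ, ∀ᶠ n in atTop, f ξ n ≤ g n := by
  by_contra hcon
  refine absurd h (not_lt.2 (le_trans (csInf_le' ⟨range f, rfl, ?_⟩) Cardinal.mk_range_le))
  rintro ⟨g, hg⟩
  exact hcon ⟨g, fun ξ => hg _ ⟨ξ, rfl⟩⟩

/-- The finite union of closed intervals with rational endpoints listed in `s`. -/
def ratIccUnion (s : Finset (ℚ × ℚ)) : Set ℝ :=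
  ⋃ p ∈ s, Icc (p.1 : ℝ) p.2

theorem isClosed_ratIccUnion (s : Finset (ℚ × ℚ)) : IsClosed (ratIccUnion s) :=
  s.finite_toSet.isClosed_biUnion fun _ _ => isClosed_Icc

theorem exists_rat_Icc_subset {U : Set ℝ} (hU : IsOpen U) {x : ℝ} (hx : x ∈ U) :
    ∃ p : ℚ × ℚ, p.1 < p.2 ∧ x ∈ Ioo (p.1 : ℝ) p.2 ∧ Icc (p.1 : ℝ) p.2 ⊆ U := by
  obtain ⟨ε, hε, hball⟩ := Metric.isOpen_iff.1 hU x hx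
  obtain ⟨p, hp1, hp2⟩ := exists_rat_btwn (show x - ε < x by linarith)
  obtain ⟨q, hq1, hq2⟩ := exists_rat_btwn (show x < x + ε by linarith)
  refine ⟨(p, q), by exact_mod_cast hp2.trans hq1, ⟨hp2, hq1⟩, fun y hy => hball ?_⟩
  rw [Metric.mem_ball, Real.dist_eq, abs_lt]
  constructor <;> linarith [hy.1, hy.2]

theorem exists_ratIccUnion_cover {K : Set ℝ} (hK : IsCompact K) (h0 : volume K = 0)
    {ε : ENNReal} (hε : 0 < ε) : ∃ s, K ⊆ ratIccUnion s ∧ volume (ratIccUnion s) ≤ ε := by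
  obtain ⟨U, hKU, hU, hUε⟩ := K.exists_isOpen_lt_of_lt ε (h0 ▸ hε)
  choose! p _ hp1 hp2 using fun x (hx : x ∈ K) => exists_rat_Icc_subset hU (hKU hx)
  obtain ⟨t, ht, htK⟩ := hK.elim_nhds_subcover (fun x => Ioo ((p x).1 : ℝ) (p x).2)
    fun x hx => isOpen_Ioo.mem_nhds (hp1 x hx)
  classical
  refine ⟨t.image p, fun x hx => ?_, (measure_mono ?_).trans hUε.le⟩
  · obtain ⟨y, hy, hxy⟩ := mem_iUnion₂.1 (htK hx)
    exact mem_iUnion₂.2 ⟨p y, Finset.mem_image_of_mem _ hy, Ioo_subset_Icc_self hxy⟩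
  · refine iUnion₂_subset fun q hq => ?_
    obtain ⟨y, hy, rfl⟩ := Finset.mem_image.1 hq
    exact hp2 y (ht y hy)

theorem GuessesInfinitelyOften.encodable {ι α : Type} [Encodable α] [Inhabited α]
    (h : GuessesInfinitelyOften ι) (f : ι → ℕ → α) :
    ∃ g : ℕ → α, ∀ ξ, ∃ᶠ n in atTop, f ξ n = g n := by
  obtain ⟨g, hg⟩ := h fun ξ n => Encodable.encode (f ξ n)
  refine ⟨fun n => (Encodable.decode (g n)).getD default, fun ξ => (hg ξ).mono fun n hn => ?_⟩
  simp [← hn]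

/-- Fewer than `𝔟` many countable unions of closed null sets are covered by a single one,
provided families of that size can be guessed infinitely often. -/
theorem IsFsigmaNull.exists_superset {ι : Type} (hι : GuessesInfinitelyOften ι)
    (hb : Cardinal.mk ι < boundingNumber) {S : ι → Set ℝ} (hS : ∀ ξ, IsFsigmaNull (S ξ)) :
    ∃ B, IsFsigmaNull B ∧ ∀ ξ, S ξ ⊆ B := by
  choose C hC hSC using hS
  obtain ⟨ε, hε, hsum⟩ := ENNReal.exists_pos_sum_of_countable' (ε := 1) one_ne_zero ℕ
  have hK : ∀ ξ n, ∃ s, (⋃ i ∈ Iic n, C ξ i ∩ Icc (-n : ℝ) n) ⊆ ratIccUnion s ∧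
      volume (ratIccUnion s) ≤ ε n := fun ξ n => by
    refine exists_ratIccUnion_cover ?_ ?_ (hε n)
    · exact (finite_Iic n).isCompact_biUnion fun i _ => isCompact_Icc.inter_left (hC ξ i).1
    · exact (measure_biUnion_null_iff (finite_Iic n).countable).2 fun i _ =>
        measure_mono_null inter_subset_left (hC ξ i).2
  choose u hu hvol using hK
  obtain ⟨g, hg⟩ := hι.encodable u
  have hd : ∀ ξ n, ∃ k ≥ n, u ξ k = g k := fun ξ n => frequently_atTop.1 (hg ξ) n
  choose d hdn hd using hd
  obtain ⟨r, hr⟩ := exists_bound_of_lt_boundingNumber hb d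
  let a : ℕ → ℕ := fun k => Nat.rec 0 (fun _ m => max m (r m) + 1) k
  have ha : ∀ k, a (k + 1) = max (a k) (r (a k)) + 1 := fun k => rfl
  have hak : ∀ k, k ≤ a k := fun k => by
    induction k with
    | zero => exact Nat.zero_le _
    | succ k ih => rw [ha]; omega
  classical
  let V : ℕ → Set ℝ := fun n => if volume (ratIccUnion (g n)) ≤ ε n then ratIccUnion (g n) else ∅
  have hVc : ∀ n, IsClosed (V n) := fun n => by
    simp only [V]; split_ifs
    · exact isClosed_ratIccUnion _
    · exact isClosed_empty
  have hVm : ∀ n, volume (V n) ≤ ε n := fun n => by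
    simp only [V]; split_ifs with h
    · exact h
    · simp
  refine ⟨⋃ m, ⋂ k ≥ m, ⋃ n ∈ Ico (a k) (a (k + 1)), V n,
    ⟨_, fun m => ⟨?_, ?_⟩, rfl⟩, fun ξ x hx => ?_⟩
  · exact isClosed_biInter fun k _ => (finite_Ico _ _).isClosed_biUnion fun n _ => hVc n
  · refine measure_mono_null (t := {x | ∃ᶠ n in atTop, x ∈ V n}) (fun x hx => ?_)
      (measure_setOfPred_frequently_eq_zero ?_)
    · refine frequently_atTop.2 fun N => ?_
      obtain ⟨n, hn, hxn⟩ := mem_iUnion₂.1 (mem_iInter₂.1 hx (max m N) (le_max_left _ _))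
      exact ⟨n, (le_max_right m N).trans ((hak _).trans hn.1), hxn⟩
    · exact ((ENNReal.tsum_le_tsum hVm).trans_lt (hsum.trans ENNReal.one_lt_top)).ne
  · rw [hSC ξ] at hx
    obtain ⟨i, hi⟩ := mem_iUnion.1 hx
    obtain ⟨N, hN⟩ := exists_nat_ge |x|
    obtain ⟨N', hN'⟩ := eventually_atTop.1 (hr ξ)
    refine mem_iUnion.2 ⟨max i (max N N'), mem_iInter₂.2 fun k hk => ?_⟩
    have hk' := hak k
    have h1 := hN' (a k) (by omega)
    have h2 := hdn ξ (a k)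
    refine mem_iUnion₂.2 ⟨d ξ (a k), ⟨h2, by rw [ha]; omega⟩, ?_⟩
    have hle : (N : ℝ) ≤ d ξ (a k) := by
      have : N ≤ d ξ (a k) := by omega
      exact_mod_cast this
    have h3 := hvol ξ (d ξ (a k))
    have h4 := hu ξ (d ξ (a k))
    rw [hd] at h3 h4
    simp only [V, if_pos h3]
    refine h4 (mem_iUnion₂.2 ⟨i, ?_, hi, ?_⟩)
    · rw [mem_Iic]; omega
    · exact abs_le.1 (hN.trans hle)

theorem GuessesInfinitelyOften.on_infinite {ι α : Type} [Encodable α] [Inhabited α]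
    (h : GuessesInfinitelyOften ι) (f : ι → ℕ → α) {X : ι → Set ℕ} (hX : ∀ ξ, (X ξ).Infinite) :
    ∃ g : ℕ → α, ∀ ξ, ∃ᶠ n in atTop, n ∈ X ξ ∧ f ξ n = g n := by
  choose Y hYX hYc using fun ξ n => (hX ξ).exists_subset_card_eq (n + 1)
  obtain ⟨g, hg⟩ := h.encodable (α := Finset ℕ × List α) fun ξ n =>
    (Y ξ n, (List.range ((Y ξ n).sup id + 1)).map (f ξ))
  let S : ℕ → Finset ℕ := fun n => if (g n).1.card = n + 1 then (g n).1 else Finset.range (n + 1)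
  have hS : ∀ n, (S n).card = n + 1 := fun n => by
    simp only [S]; split_ifs with hn
    · exact hn
    · simp
  obtain ⟨p, hp, hpS⟩ := (Finset.all_card_le_biUnion_card_iff_exists_injective S).1 fun s => by
    rcases s.eq_empty_or_nonempty with rfl | hs
    · simp
    · calc s.card ≤ (Finset.range (s.max' hs + 1)).card := Finset.card_le_card fun i hi =>
            Finset.mem_range.2 (Nat.lt_succ_of_le (s.le_max' i hi))
        _ = (S (s.max' hs)).card := by rw [hS, Finset.card_range]
        _ ≤ _ := Finset.card_le_card (Finset.subset_biUnion_of_mem S (s.max'_mem hs))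
  refine ⟨fun x => (g (Function.invFun p x)).2.getD x default, fun ξ => ?_⟩
  rw [Nat.frequently_atTop_iff_infinite]
  refine ((Nat.frequently_atTop_iff_infinite.1 (hg ξ)).image hp.injOn).mono ?_
  rintro _ ⟨n, hn, rfl⟩
  have hn1 : Y ξ n = (g n).1 := congrArg Prod.fst hn
  have hn2 := congrArg Prod.snd hn
  have hpY : p n ∈ Y ξ n := by
    have := hpS n
    simpa only [S, ← hn1, hYc, if_true] using this
  refine ⟨hYX ξ n hpY, ?_⟩
  have hlt : p n < (Y ξ n).sup id + 1 := Nat.lt_succ_of_le (Finset.le_sup (f := id) hpY)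
  simp only [Function.leftInverse_invFun hp n, ← hn2]
  simp [List.getD, hlt]

/-- If `F (F n) ≤ r n` infinitely often, then `F` maps infinitely many points of the orbit of
`0` under `r` below their successors. -/
theorem infinite_orbit_bound {F r : ℕ → ℕ} (hF : Monotone F) (hr : Monotone r)
    (hrlt : ∀ n, n < r n) (hFr : ∃ᶠ n in atTop, F (F n) ≤ r n) :
    {k | F (r^[k] 0) ≤ r^[k + 1] 0}.Infinite := by
  have hstep : ∀ k, r^[k + 1] 0 = r (r^[k] 0) := fun k => Function.iterate_succ_apply' r k 0
  have hmono : StrictMono fun k => r^[k] 0 := strictMono_nat_of_lt_succ fun k => by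
    rw [hstep]; exact hrlt _
  rw [← Nat.frequently_atTop_iff_infinite, frequently_atTop]
  intro N
  obtain ⟨l, hl, hFl⟩ := frequently_atTop.1 hFr (r^[N] 0)
  have hex : ∃ k, l < r^[k] 0 := ⟨l + 1, Nat.lt_of_lt_of_le (Nat.lt_succ_self l) (hmono.le_apply)⟩
  classical
  set k := Nat.find hex with hk
  have hlk : l < r^[k] 0 := Nat.find_spec hex
  have hNk : N < k := hmono.lt_iff_lt.1 (hl.trans_lt hlk)
  obtain ⟨j, hj⟩ : ∃ j, k = j + 1 := ⟨k - 1, by omega⟩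
  have hjl : r^[j] 0 ≤ l := not_lt.1 (Nat.find_min hex (by omega))
  have h1 : F (F (r^[j] 0)) ≤ r^[j + 2] 0 := by
    rw [hstep (j + 1)]
    exact (hF (hF hjl)).trans (hFl.trans (hr (hj ▸ hlk.le)))
  by_cases h2 : F (r^[j] 0) ≤ r^[j + 1] 0
  · exact ⟨j, by omega, h2⟩
  · exact ⟨j + 1, by omega, (hF (not_le.1 h2).le).trans h1⟩

/-- A single play agrees, at arbitrarily late stages, with each of the strategies `t ξ`. -/
theorem GuessesInfinitelyOften.exists_path {ι : Type} (h : GuessesInfinitelyOften ι)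
    {rel : ℕ → ℕ → Prop} (hrefl : ∀ i, rel i i) {t : ι → ℕ → ℕ → ℕ}
    (ht : ∀ ξ n i, rel i (t ξ n i)) :
    ∃ s : ℕ → ℕ, (∀ k, rel (s k) (s (k + 1))) ∧
      ∀ ξ N, ∃ n ≥ N, ∃ k, s (k + 1) = t ξ n (s k) := by
  let F : ι → ℕ → ℕ := fun ξ n =>
    (Finset.range (n + 1) ×ˢ Finset.range (n + 1)).sup fun p => t ξ p.1 p.2
  have hF : ∀ ξ, Monotone (F ξ) := fun ξ m n hmn => Finset.sup_mono
    (Finset.product_subset_product (Finset.range_mono (by omega)) (Finset.range_mono (by omega)))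
  have htF : ∀ ξ n i, i ≤ n → t ξ n i ≤ F ξ n := fun ξ n i hi =>
    Finset.le_sup (f := fun p : ℕ × ℕ => t ξ p.1 p.2) (b := (n, i)) (by simp; omega)
  obtain ⟨g, hg⟩ := h fun ξ n => F ξ (F ξ n)
  let r : ℕ → ℕ := fun n => n + 1 + (Finset.range (n + 1)).sup g
  have hr : Monotone r := fun m n hmn => by
    have : (Finset.range (m + 1)).sup g ≤ (Finset.range (n + 1)).sup g :=
      Finset.sup_mono (Finset.range_mono (by omega))
    simp only [r]; omega
  have hrlt : ∀ n, n < r n := fun n => by simp only [r]; omega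
  have hgr : ∀ n, g n ≤ r n := fun n => by
    have : g n ≤ (Finset.range (n + 1)).sup g := Finset.le_sup (by simp)
    simp only [r]; omega
  have hX : ∀ ξ, {k | F ξ (r^[k] 0) ≤ r^[k + 1] 0}.Infinite := fun ξ =>
    infinite_orbit_bound (hF ξ) hr hrlt ((hg ξ).mono fun n hn => hn.le.trans (hgr n))
  set a : ℕ → ℕ := fun k => r^[k] 0 with ha
  have hmono : StrictMono a := strictMono_nat_of_lt_succ fun k => by
    simp only [ha, Function.iterate_succ_apply']; exact hrlt _
  obtain ⟨G, hG⟩ := h.on_infinite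
    (fun ξ k => (List.range (a k + 1)).map (t ξ (a k))) hX
  classical
  let v : ℕ → ℕ → ℕ := fun k i => (G k).getD i 0
  let s : ℕ → ℕ := fun k => Nat.rec 0
    (fun k i => if rel i (v k i) ∧ v k i ≤ a (k + 1) then v k i else i) k
  have hs : ∀ k, s (k + 1) =
    if rel (s k) (v k (s k)) ∧ v k (s k) ≤ a (k + 1) then v k (s k) else s k := fun k => rfl
  have hsa : ∀ k, s k ≤ a k := fun k => by
    induction k with
    | zero => exact Nat.zero_le _
    | succ k ih =>
      rw [hs]; split_ifs with hk
      · exact hk.2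
      · exact ih.trans (hmono (Nat.lt_succ_self k)).le
  refine ⟨s, fun k => ?_, fun ξ N => ?_⟩
  · rw [hs]; split_ifs with hk
    · exact hk.1
    · exact hrefl _
  · obtain ⟨k, hk, hkX, hkG⟩ := frequently_atTop.1 (hG ξ) N
    refine ⟨a k, hk.trans hmono.le_apply, k, ?_⟩
    have hv : v k (s k) = t ξ (a k) (s k) := by
      have := hsa k
      simp only [v, ← hkG]
      simp [List.getD, Nat.lt_succ_of_le this]
    rw [hs, hv, if_pos ⟨ht ξ _ _, (htF ξ _ _ (hsa k)).trans hkX⟩]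

theorem GuessesInfinitelyOften.iUnion_meagre_ne_univ {ι : Type} (h : GuessesInfinitelyOften ι)
    {M : ι → Set ℝ} (hM : ∀ ξ, IsMeagre (M ξ)) : ⋃ ξ, M ξ ≠ univ := by
  have hO : ∀ ξ, ∃ O : ℕ → Set ℝ, (∀ n, IsOpen (O n)) ∧ (∀ n, Dense (O n)) ∧
      ⋂ n, O n ⊆ (M ξ)ᶜ := fun ξ => by
    obtain ⟨t, htM, htG, htd⟩ := mem_residual.1 (hM ξ)
    obtain ⟨O, hO, rfl⟩ := htG.eq_iInter_nat
    exact ⟨O, hO, fun n => htd.mono (iInter_subset _ n), htM⟩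
  choose O hOo hOd hOM using hO
  have : Nonempty {p : ℚ × ℚ // p.1 < p.2} := ⟨⟨(0, 1), by norm_num⟩⟩
  obtain ⟨e, he⟩ := exists_surjective_nat {p : ℚ × ℚ // p.1 < p.2}
  let K : ℕ → Set ℝ := fun i => Icc ((e i).1.1 : ℝ) (e i).1.2
  have hlt : ∀ i, ((e i).1.1 : ℝ) < (e i).1.2 := fun i => by exact_mod_cast (e i).2
  have hex : ∀ ξ n i, ∃ j, K j ⊆ K i ∧ K j ⊆ ⋂ m ∈ Iic n, O ξ m := fun ξ n i => by
    have ho : IsOpen (⋂ m ∈ Iic n, O ξ m) := (finite_Iic n).isOpen_biInter fun m _ => hOo ξ m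
    have hd : Dense (⋂ m ∈ Iic n, O ξ m) :=
      dense_biInter_of_isOpen (fun m _ => hOo ξ m) (finite_Iic n).countable fun m _ => hOd ξ m
    obtain ⟨x, hx⟩ := hd.inter_open_nonempty (Ioo ((e i).1.1 : ℝ) (e i).1.2) isOpen_Ioo
      (nonempty_Ioo.2 (hlt i))
    obtain ⟨p, hp, -, hps⟩ := exists_rat_Icc_subset (isOpen_Ioo.inter ho) hx
    obtain ⟨j, hj⟩ := he ⟨p, hp⟩
    have hK : K j = Icc (p.1 : ℝ) p.2 := by simp only [K, hj]
    exact ⟨j, hK ▸ hps.trans (inter_subset_left.trans Ioo_subset_Icc_self),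
      hK ▸ hps.trans inter_subset_right⟩
  choose t htK htO using hex
  obtain ⟨s, hs, hst⟩ := h.exists_path (rel := fun i j => K j ⊆ K i) (fun _ => Subset.rfl) htK
  obtain ⟨x, hx⟩ := IsCompact.nonempty_iInter_of_sequence_nonempty_isCompact_isClosed
    (fun k => K (s k)) hs (fun k => nonempty_Icc.2 (hlt _).le) isCompact_Icc fun k => isClosed_Icc
  rw [mem_iInter] at hx
  intro hu
  obtain ⟨ξ, hξ⟩ := mem_iUnion.1 (hu.symm ▸ mem_univ x)
  refine hOM ξ (mem_iInter.2 fun m => ?_) hξ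
  obtain ⟨n, hn, k, hk⟩ := hst ξ m
  exact mem_iInter₂.1 (htO ξ n (s k) (hk ▸ hx (k + 1))) m hn

/-- A Bessel-type inequality: the set `W` cannot correlate with many orthogonal functions. -/
theorem card_mul_sq_le_measure {ν : Measure ℝ} [IsFiniteMeasure ν] {c : ℕ → ℝ → ℝ}
    (hc : ∀ i, Continuous (c i)) (hb : ∀ i x, |c i x| ≤ 2)
    (horth : ∀ i j, i ≠ j → ∫ x, c i x * c j x ∂ν = 0) (hnorm : ∀ i, ∫ x, c i x * c i x ∂ν ≤ 1)
    {W : Set ℝ} (hW : MeasurableSet W) {J : Finset ℕ} {δ : ℝ} (hδ : 0 ≤ δ)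
    (hJ : ∀ i ∈ J, δ ≤ ∫ x in W, c i x ∂ν) : J.card * δ ^ 2 ≤ ν.real W := by
  have hi : ∀ i, Integrable (c i) ν := fun i =>
    Integrable.of_bound (hc i).aestronglyMeasurable 2 (Eventually.of_forall (hb i))
  have hij : ∀ i j, Integrable (fun x => c i x * c j x) ν := fun i j =>
    Integrable.of_bound ((hc i).mul (hc j)).aestronglyMeasurable (2 * 2)
      (Eventually.of_forall fun x => by
        rw [Real.norm_eq_abs, abs_mul]
        exact mul_le_mul (hb i x) (hb j x) (abs_nonneg _) (by norm_num))
  have hWc : ∀ i, Integrable (W.indicator (c i)) ν := fun i => (hi i).indicator hW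
  have hW1 : Integrable (W.indicator fun _ => (1 : ℝ)) ν := (integrable_const 1).indicator hW
  have hexp : ∀ x, (W.indicator (fun _ => (1 : ℝ)) x - δ * ∑ i ∈ J, c i x) ^ 2 =
      W.indicator (fun _ => (1 : ℝ)) x - 2 * δ * ∑ i ∈ J, W.indicator (c i) x +
        δ ^ 2 * ∑ i ∈ J, ∑ j ∈ J, c i x * c j x := fun x => by
    rw [← Finset.sum_mul_sum]
    by_cases hx : x ∈ W
    · simp only [indicator_of_mem hx]; ring
    · simp only [indicator_of_notMem hx, Finset.sum_const_zero]; ring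
  have h0 : 0 ≤ ∫ x, (W.indicator (fun _ => (1 : ℝ)) x - δ * ∑ i ∈ J, c i x) ^ 2 ∂ν :=
    integral_nonneg fun x => sq_nonneg _
  have hS1 : Integrable (fun x => 2 * δ * ∑ i ∈ J, W.indicator (c i) x) ν :=
    (integrable_finsetSum J fun i _ => hWc i).const_mul _
  have hS2 : Integrable (fun x => δ ^ 2 * ∑ i ∈ J, ∑ j ∈ J, c i x * c j x) ν :=
    (integrable_finsetSum J fun i _ => integrable_finsetSum J fun j _ => hij i j).const_mul _
  rw [integral_congr_ae (Eventually.of_forall hexp), integral_add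
      (show Integrable (fun x => W.indicator (fun _ => (1 : ℝ)) x -
        2 * δ * ∑ i ∈ J, W.indicator (c i) x) ν from hW1.sub hS1) hS2,
    integral_sub hW1 hS1, integral_const_mul, integral_const_mul,
    integral_finsetSum J fun i _ => hWc i,
    integral_finsetSum J fun i _ => integrable_finsetSum J fun j _ => hij i j,
    integral_indicator hW, setIntegral_const, smul_eq_mul, mul_one] at h0
  have h1 : J.card * δ ≤ ∑ i ∈ J, ∫ x, W.indicator (c i) x ∂ν := by
    rw [← nsmul_eq_mul]
    exact Finset.card_nsmul_le_sum _ _ _ fun i hiJ =>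
      (integral_indicator hW (f := c i)).symm ▸ hJ i hiJ
  have h2 : ∑ i ∈ J, ∫ x, ∑ j ∈ J, c i x * c j x ∂ν ≤ J.card := by
    rw [Finset.card_eq_sum_ones, Nat.cast_sum]
    refine Finset.sum_le_sum fun i hiJ => ?_
    rw [integral_finsetSum J fun j _ => hij i j, Finset.sum_eq_single_of_mem i hiJ
      fun j _ hj => horth i j hj.symm]
    simpa using hnorm i
  nlinarith [mul_le_mul_of_nonneg_left h1 hδ, mul_le_mul_of_nonneg_left h2 (sq_nonneg δ)]

/-- The character `cos (2 π n x)`. -/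
noncomputable def cosWave (n : ℕ) (x : ℝ) : ℝ := Real.cos (2 * Real.pi * n * x)

theorem continuous_cosWave (n : ℕ) : Continuous (cosWave n) := by
  unfold cosWave; fun_prop

theorem abs_cosWave_le (n : ℕ) (x : ℝ) : |cosWave n x| ≤ 1 := Real.abs_cos_le_one _

theorem integrable_cosWave (n : ℕ) {ν : Measure ℝ} [IsFiniteMeasure ν] :
    Integrable (cosWave n) ν :=
  Integrable.of_bound (continuous_cosWave n).aestronglyMeasurable 1
    (Eventually.of_forall (abs_cosWave_le n))

theorem integral_cos_two_pi_int (k : ℤ) (hk : k ≠ 0) :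
    ∫ x in Icc (0 : ℝ) 1, Real.cos (2 * Real.pi * k * x) = 0 := by
  have hk' : (2 * Real.pi * k : ℝ) ≠ 0 := by
    have : (k : ℝ) ≠ 0 := by exact_mod_cast hk
    positivity
  rw [integral_Icc_eq_integral_Ioc, ← intervalIntegral.integral_of_le zero_le_one,
    intervalIntegral.integral_comp_mul_left _ hk', integral_cos]
  have : Real.sin (2 * Real.pi * k) = 0 := by
    rw [show 2 * Real.pi * k = ((2 * k : ℤ) : ℝ) * Real.pi by push_cast; ring]
    exact Real.sin_int_mul_pi _
  simp [this]

theorem cosWave_mul (a b : ℕ) (x : ℝ) : cosWave a x * cosWave b x =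
    (Real.cos (2 * Real.pi * ((a - b : ℤ) : ℝ) * x) +
      Real.cos (2 * Real.pi * ((a + b : ℤ) : ℝ) * x)) / 2 := by
  have h1 : 2 * Real.pi * ((a - b : ℤ) : ℝ) * x = 2 * Real.pi * a * x - 2 * Real.pi * b * x := by
    push_cast; ring
  have h2 : 2 * Real.pi * ((a + b : ℤ) : ℝ) * x = 2 * Real.pi * a * x + 2 * Real.pi * b * x := by
    push_cast; ring
  rw [h1, h2, Real.cos_sub, Real.cos_add]
  unfold cosWave
  ring

theorem integral_cosWave_mul {a b : ℕ} (ha : a ≠ 0) :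
    ∫ x in Icc (0 : ℝ) 1, cosWave a x * cosWave b x = if a = b then 1 / 2 else 0 := by
  have hi : ∀ k : ℤ, Integrable (fun x : ℝ => Real.cos (2 * Real.pi * k * x))
      (volume.restrict (Icc (0 : ℝ) 1)) := fun k =>
    
    (show Continuous fun x : ℝ => Real.cos (2 * Real.pi * k * x) by fun_prop).integrableOn_Icc
  simp_rw [cosWave_mul]
  rw [integral_div, integral_add (hi _) (hi _), integral_cos_two_pi_int (a + b) (by omega)]
  split_ifs with h
  · subst h; simp
  · rw [integral_cos_two_pi_int _ (by omega)]; simp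

/-- The closed set where `cos (2 π (2 i + 1) x)` is at least `-1/4`. -/
def waveSet (i : ℕ) : Set ℝ := {x | -(1 / 4) ≤ cosWave (2 * i + 1) x}

theorem isClosed_waveSet (i : ℕ) : IsClosed (waveSet i) :=
  isClosed_le continuous_const (continuous_cosWave _)

theorem card_mul_measure_le {W : Set ℝ} (hW : MeasurableSet W) {J : Finset ℕ}
    (hJ : ∀ i ∈ J, (volume.restrict (Icc 0 1)).real (W ∩ waveSet i) <
      (volume.restrict (Icc 0 1)).real W / 16) :
    J.card * (volume.restrict (Icc 0 1)).real W ≤ 64 := by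
  set ν : Measure ℝ := volume.restrict (Icc 0 1) with hν
  rcases (measureReal_nonneg : 0 ≤ ν.real W).eq_or_lt with h0 | hpos
  · rw [← h0]; norm_num
  have key := card_mul_sq_le_measure (ν := ν) (c := fun i x => -cosWave (2 * i + 1) x)
    (fun i => (continuous_cosWave _).neg)
    (fun i x => by rw [abs_neg]; linarith [abs_cosWave_le (2 * i + 1) x])
    (fun i j hij => by
      simp only [neg_mul_neg]
      rw [integral_cosWave_mul (by omega), if_neg (by omega)])
    (fun i => by
      simp only [neg_mul_neg]
      rw [integral_cosWave_mul (by omega), if_pos rfl]; norm_num)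
    hW (J := J) (δ := ν.real W / 8) (by positivity) fun i hi => by
      have hA : MeasurableSet (waveSet i) := (isClosed_waveSet i).measurableSet
      have hint : Integrable (fun x => -cosWave (2 * i + 1) x) ν := (integrable_cosWave _).neg
      rw [← integral_inter_add_sdiff hA hint.integrableOn]
      have h1 : -ν.real (W ∩ waveSet i) ≤ ∫ x in W ∩ waveSet i, -cosWave (2 * i + 1) x ∂ν := by
        have := setIntegral_mono_on (μ := ν) (s := W ∩ waveSet i) (f := fun _ => (-1 : ℝ))
          (integrable_const _) hint.integrableOn (hW.inter hA) fun x _ =>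
            neg_le_neg (abs_le.1 (abs_cosWave_le (2 * i + 1) x)).2
        simpa using this
      have h2 : ν.real (W \ waveSet i) / 4 ≤
          ∫ x in W \ waveSet i, -cosWave (2 * i + 1) x ∂ν := by
        have := setIntegral_mono_on (μ := ν) (s := W \ waveSet i) (f := fun _ => (1 / 4 : ℝ))
          (integrable_const _) hint.integrableOn (hW.diff hA) fun x hx => by
            have : ¬ -(1 / 4) ≤ cosWave (2 * i + 1) x := hx.2
            linarith
        rw [setIntegral_const, smul_eq_mul] at this
        linarith
      have h3 := measureReal_inter_add_sdiff (μ := ν) (s := W) hA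
      have h4 := hJ i hi
      linarith
  nlinarith

theorem measureReal_eq_zero_of_subset_waveSet {W : Set ℝ} (hW : MeasurableSet W) {I : Set ℕ}
    (hI : I.Infinite) (hWI : ∀ i ∈ I, W ⊆ waveSet i) :
    (volume.restrict (Icc 0 1)).real W = 0 := by
  set ν : Measure ℝ := volume.restrict (Icc 0 1) with hν
  by_contra hne
  have hpos : 0 < ν.real W := lt_of_le_of_ne measureReal_nonneg (Ne.symm hne)
  let c : ℕ → ℝ → ℝ := fun i x => cosWave (2 * i + 1) x - 3 / 4 * cosWave (2 * (2 * i + 1)) x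
  have hm : ∀ a b, Integrable (fun x => cosWave a x * cosWave b x) ν := fun a b =>
    Continuous.integrableOn_Icc ((continuous_cosWave a).mul (continuous_cosWave b))
  have hcc : ∀ i j, ∫ x, c i x * c j x ∂ν =
      (if i = j then 1 / 2 else 0) + 9 / 16 * if i = j then 1 / 2 else 0 := fun i j => by
    have : ∀ x, c i x * c j x = cosWave (2 * i + 1) x * cosWave (2 * j + 1) x
        - 3 / 4 * (cosWave (2 * i + 1) x * cosWave (2 * (2 * j + 1)) x)
        - 3 / 4 * (cosWave (2 * (2 * i + 1)) x * cosWave (2 * j + 1) x)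
        + 9 / 16 * (cosWave (2 * (2 * i + 1)) x * cosWave (2 * (2 * j + 1)) x) := fun x => by
      simp only [c]; ring
    simp_rw [this]
    rw [integral_add, integral_sub, integral_sub, integral_const_mul, integral_const_mul,
      integral_const_mul, integral_cosWave_mul (by omega), integral_cosWave_mul (by omega),
      integral_cosWave_mul (by omega), integral_cosWave_mul (by omega)]
    · rw [if_neg (show ¬ 2 * i + 1 = 2 * (2 * j + 1) by omega),
        if_neg (show ¬ 2 * (2 * i + 1) = 2 * j + 1 by omega)]
      simp
    · exact hm _ _
    · exact (hm _ _).const_mul _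
    · exact (hm _ _).sub ((hm _ _).const_mul _)
    · exact (hm _ _).const_mul _
    · exact ((hm _ _).sub ((hm _ _).const_mul _)).sub ((hm _ _).const_mul _)
    · exact (hm _ _).const_mul _
  have hcont : ∀ i, Continuous (c i) := fun i =>
    (continuous_cosWave _).sub ((continuous_cosWave _).const_mul _)
  have hdouble : ∀ n x, cosWave (2 * n) x = 2 * cosWave n x ^ 2 - 1 := fun n x => by
    unfold cosWave
    rw [← Real.cos_two_mul]; push_cast; ring_nf
  obtain ⟨k, hk⟩ := exists_nat_gt (16 / ν.real W)
  obtain ⟨J, hJI, hJk⟩ := hI.exists_subset_card_eq k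
  have key := card_mul_sq_le_measure (ν := ν) (c := c) hcont
    (fun i x => by
      have h1 := abs_le.1 (abs_cosWave_le (2 * i + 1) x)
      have h2 := abs_le.1 (abs_cosWave_le (2 * (2 * i + 1)) x)
      simp only [c]
      rw [abs_le]
      constructor <;> linarith [h1.1, h1.2, h2.1, h2.2])
    (fun i j hij => by rw [hcc, if_neg hij]; norm_num)
    (fun i => by rw [hcc, if_pos rfl]; norm_num)
    hW (J := J) (δ := ν.real W / 4) (by positivity) fun i hi => by
      have := setIntegral_mono_on (μ := ν) (s := W) (f := fun _ => (1 / 4 : ℝ)) (g := c i)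
        (integrable_const _) ((hcont i).integrableOn_Icc.integrableOn) hW fun x hx => by
          have h1 : -(1 / 4) ≤ cosWave (2 * i + 1) x := hWI i (hJI hi) hx
          have h2 := (abs_le.1 (abs_cosWave_le (2 * i + 1) x)).2
          simp only [c, hdouble]
          nlinarith
      rw [setIntegral_const, smul_eq_mul] at this
      linarith
  rw [hJk] at key
  rw [div_lt_iff₀ hpos] at hk
  nlinarith

/-- The points of `[0, 1]` lying in the wave sets selected by `h` from stage `m` on. -/
def waveTail (h : ℕ → ℕ) (m : ℕ) : Set ℝ :=
  Icc 0 1 ∩ ⋂ i ≥ m, waveSet (Nat.pair i (h i))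

theorem isClosed_waveTail (h : ℕ → ℕ) (m : ℕ) : IsClosed (waveTail h m) :=
  isClosed_Icc.inter (isClosed_biInter fun _ _ => isClosed_waveSet _)

theorem volume_waveTail (h : ℕ → ℕ) (m : ℕ) : volume (waveTail h m) = 0 := by
  have hinj : Function.Injective fun i => Nat.pair i (h i) := fun i j hij =>
    (Nat.pair_eq_pair.1 hij).1
  have h0 := measureReal_eq_zero_of_subset_waveSet (isClosed_waveTail h m).measurableSet
    ((Ici_infinite m).image hinj.injOn) (by
      rintro _ ⟨i, hi, rfl⟩ x hx
      exact mem_iInter₂.1 hx.2 i hi)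
  rwa [measureReal_eq_zero_iff, Measure.restrict_apply (isClosed_waveTail h m).measurableSet,
    inter_eq_left.2 (show waveTail h m ⊆ Icc 0 1 from inter_subset_left)] at h0

/-- The list of the first `n` values of `h`, latest first. -/
def revTake (h : ℕ → ℕ) : ℕ → List ℕ
  | 0 => []
  | n + 1 => h n :: revTake h n

theorem length_revTake (h : ℕ → ℕ) (n : ℕ) : (revTake h n).length = n := by
  induction n with
  | zero => rfl
  | succ n ih => simp [revTake, ih]

/-- The part of `P` lying in the wave sets selected by the entries of `L` (latest first) from
stage `m` on. -/
def waveNode (P : Set ℝ) (m : ℕ) : List ℕ → Set ℝ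
  | [] => P
  | j :: L => if L.length < m then waveNode P m L
      else waveNode P m L ∩ waveSet (Nat.pair L.length j)

theorem isClosed_waveNode {P : Set ℝ} (hP : IsClosed P) (m : ℕ) (L : List ℕ) :
    IsClosed (waveNode P m L) := by
  induction L with
  | nil => exact hP
  | cons j L ih =>
    rw [waveNode]; split_ifs
    · exact ih
    · exact ih.inter (isClosed_waveSet _)

theorem waveNode_revTake_of_le (P : Set ℝ) (h : ℕ → ℕ) {m n : ℕ} (hn : n ≤ m) :
    waveNode P m (revTake h n) = P := by
  induction n with
  | zero => rfl
  | succ n ih => rw [revTake, waveNode, length_revTake, if_pos (by omega), ih (by omega)]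

theorem waveNode_revTake_succ (P : Set ℝ) (h : ℕ → ℕ) {m n : ℕ} (hn : m ≤ n) :
    waveNode P m (revTake h (n + 1)) =
      waveNode P m (revTake h n) ∩ waveSet (Nat.pair n (h n)) := by
  rw [revTake, waveNode, length_revTake, if_neg (by omega)]

/-- If the tails selected by a family of functions have null union, a single predictor proposes,
for each member and infinitely often, a list of values of prescribed length containing
the correct one. -/
theorem exists_predictor {ι : Type} (H : ι → ℕ → ℕ)
    (hH : volume (⋃ ξ, ⋃ m, waveTail (H ξ) m) = 0) :
    ∃ p : ℕ → List ℕ → ℕ → ℕ, ∀ ξ m, ∃ n ≥ m, ∃ i < 128 * 16 ^ n,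
      H ξ n = p m (revTake (H ξ) n) i := by
  set ν : Measure ℝ := volume.restrict (Icc 0 1) with hν
  obtain ⟨U, hNU, hU, hUlt⟩ := (⋃ ξ, ⋃ m, waveTail (H ξ) m).exists_isOpen_lt_of_lt
    (ENNReal.ofReal (1 / 2)) (hH ▸ ENNReal.ofReal_pos.2 (by norm_num))
  set P : Set ℝ := Icc 0 1 \ U with hP
  have hPc : IsClosed P := isClosed_Icc.sdiff hU
  have hPm : 1 / 2 ≤ ν.real P := by
    have h1 : ν.real (Icc 0 1 ∩ U) + ν.real P = ν.real (Icc 0 1) :=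
      measureReal_inter_add_sdiff hU.measurableSet
    have h2 : ν.real (Icc 0 1) = 1 := by
      simp [hν, measureReal_def]
    have h3 : ν.real (Icc 0 1 ∩ U) ≤ 1 / 2 := by
      refine ENNReal.toReal_le_of_le_ofReal (by norm_num) ?_
      exact (measure_mono inter_subset_right).trans ((Measure.restrict_apply_le _ _).trans hUlt.le)
    linarith
  let J : ℕ → List ℕ → Set ℕ := fun m L =>
    {j | ν.real (waveNode P m L ∩ waveSet (Nat.pair L.length j)) < ν.real (waveNode P m L) / 16}
  have hJ : ∀ m L, ∃ e : ℕ → ℕ, 1 / 2 * (1 / 16) ^ L.length ≤ ν.real (waveNode P m L) →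
      ∀ j ∈ J m L, ∃ i < 128 * 16 ^ L.length, j = e i := fun m L => by
    by_cases hL : 1 / 2 * (1 / 16) ^ L.length ≤ ν.real (waveNode P m L)
    swap
    · exact ⟨id, fun h => absurd h hL⟩
    have hcard : ∀ s : Finset ℕ, ↑s ⊆ J m L → s.card ≤ 128 * 16 ^ L.length := fun s hs => by
      have key := card_mul_measure_le (isClosed_waveNode hPc m L).measurableSet
        (J := s.map ⟨Nat.pair L.length, fun i j hij => (Nat.pair_eq_pair.1 hij).2⟩) (by
          intro i hi
          obtain ⟨j, hj, rfl⟩ := Finset.mem_map.1 hi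
          exact hs hj)
      rw [Finset.card_map] at key
      have h1 : (s.card : ℝ) * (1 / 2 * (1 / 16) ^ L.length) ≤ 64 :=
        (mul_le_mul_of_nonneg_left hL (Nat.cast_nonneg _)).trans key
      have h2 : (s.card : ℝ) ≤ 128 * 16 ^ L.length := by
        rw [one_div_pow] at h1
        field_simp at h1
        linarith
      exact_mod_cast h2
    have hfin : (J m L).Finite := by
      by_contra hinf
      obtain ⟨s, hs, hsc⟩ := Set.Infinite.exists_subset_card_eq hinf (128 * 16 ^ L.length + 1)
      have := hcard s hs
      omega
    refine ⟨fun i => hfin.toFinset.toList.getD i 0, fun _ j hj => ?_⟩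
    have hj' : j ∈ hfin.toFinset.toList := by simpa using hj
    obtain ⟨i, hi, hij⟩ := List.getElem_of_mem hj'
    refine ⟨i, hi.trans_le ?_, (hij.symm.trans (List.getD_eq_getElem _ _ hi).symm)⟩
    rw [Finset.length_toList]
    exact hcard _ (by simp)
  choose p hp using hJ
  refine ⟨p, fun ξ m => ?_⟩
  by_contra! hcon
  set Q : ℕ → Set ℝ := fun n => waveNode P m (revTake (H ξ) n) with hQ
  have hbig : ∀ k, 1 / 2 * (1 / 16) ^ (m + k) ≤ ν.real (Q (m + k)) := fun k => by
    induction k with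
    | zero =>
      simp only [hQ, add_zero, waveNode_revTake_of_le P (H ξ) le_rfl]
      refine le_trans ?_ hPm
      have : (1 / 16 : ℝ) ^ m ≤ 1 := pow_le_one₀ (by norm_num) (by norm_num)
      linarith
    | succ k ih =>
      by_contra! hlt
      obtain ⟨i, hi, hij⟩ := hp m (revTake (H ξ) (m + k)) (by rwa [length_revTake])
        (H ξ (m + k)) (by
          rw [mem_ofPred_eq, length_revTake,
            ← waveNode_revTake_succ P (H ξ) (Nat.le_add_right m k)]
          refine hlt.trans_le ?_
          rw [← add_assoc, pow_succ]
          linarith)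
      rw [length_revTake] at hi
      exact hcon (m + k) (Nat.le_add_right m k) i hi hij
  have hsucc : ∀ k, Q (m + (k + 1)) = Q (m + k) ∩ waveSet (Nat.pair (m + k) (H ξ (m + k))) :=
    fun k => waveNode_revTake_succ P (H ξ) (Nat.le_add_right m k)
  have hQ0 : Q (m + 0) = P := waveNode_revTake_of_le P (H ξ) le_rfl
  obtain ⟨x, hx⟩ := IsCompact.nonempty_iInter_of_sequence_nonempty_isCompact_isClosed
    (fun k => Q (m + k)) (fun k => (hsucc k).trans_subset inter_subset_left)
    (fun k => by
      by_contra hempty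
      have h1 := hbig k
      rw [not_nonempty_iff_eq_empty.1 hempty, measureReal_empty] at h1
      have : (0 : ℝ) < 1 / 2 * (1 / 16) ^ (m + k) := by positivity
      linarith)
    (hQ0 ▸ isCompact_Icc.diff hU) (fun k => isClosed_waveNode hPc _ _)
  rw [mem_iInter] at hx
  have hxP : x ∈ P := hQ0 ▸ hx 0
  refine hxP.2 (hNU (mem_iUnion₂.2 ⟨ξ, m, hxP.1, mem_iInter₂.2 fun i hi => ?_⟩))
  obtain ⟨k, rfl⟩ := Nat.exists_eq_add_of_le hi
  exact (hsucc k ▸ hx (k + 1)).2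

/-- If every `ι`-indexed family of countable unions of closed null sets has null union, then
`ι`-indexed families of functions can be guessed infinitely often. -/
theorem guessesInfinitelyOften_of_null_iUnion {ι : Type}
    (hι : ∀ S : ι → Set ℝ, (∀ ξ, IsFsigmaNull (S ξ)) → volume (⋃ ξ, S ξ) = 0) :
    GuessesInfinitelyOften ι := by
  intro f
  let code : ℕ × List ℕ × ℕ → ℕ := Encodable.encode
  let N : List ℕ → ℕ := fun L =>
    (Finset.range (L.length + 1) ×ˢ Finset.range (128 * 16 ^ L.length)).sup
      (fun q => code (q.1, L, q.2)) + 1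
  let step : ι → List ℕ → ℕ := fun ξ L => Encodable.encode ((List.range (N L)).map (f ξ))
  let hist : ι → ℕ → List ℕ := fun ξ n => Nat.rec [] (fun _ L => step ξ L :: L) n
  have hhist : ∀ ξ n, revTake (fun k => step ξ (hist ξ k)) n = hist ξ n := fun ξ n => by
    induction n with
    | zero => rfl
    | succ n ih => rw [revTake, ih]
  obtain ⟨p, hp⟩ := exists_predictor (fun ξ k => step ξ (hist ξ k)) (hι _ fun ξ =>
    ⟨_, fun m => ⟨isClosed_waveTail _ m, volume_waveTail _ m⟩, rfl⟩)
  let value : ℕ → ℕ × List ℕ × ℕ → ℕ := fun k q =>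
    ((Encodable.decode (p q.1 q.2.1 q.2.2) : Option (List ℕ)).getD []).getD k 0
  refine ⟨fun k => ((Encodable.decode k).map (value k)).getD 0, fun ξ => ?_⟩
  choose n hn i hi hni using hp ξ
  simp only [hhist] at hni
  rw [Nat.frequently_atTop_iff_infinite]
  refine infinite_of_injective_forall_mem (f := fun m => code (m, hist ξ (n m), i m))
    (fun m m' hm => congrArg Prod.fst (Encodable.encode_injective hm)) fun m => ?_
  have hlen : (hist ξ (n m)).length = n m := by rw [← hhist, length_revTake]
  have hlt : code (m, hist ξ (n m), i m) < N (hist ξ (n m)) := Nat.lt_succ_of_le <|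
    Finset.le_sup (f := fun q : ℕ × ℕ => code (q.1, hist ξ (n m), q.2)) (b := (m, i m)) <| by
      rw [Finset.mem_product, Finset.mem_range, Finset.mem_range, hlen]
      exact ⟨Nat.lt_succ_of_le (hn m), hi m⟩
  have hdec : (Encodable.decode (code (m, hist ξ (n m), i m)) : Option (ℕ × List ℕ × ℕ)) =
    some (m, hist ξ (n m), i m) := Encodable.encodek _
  rw [mem_ofPred_eq]
  beta_reduce
  rw [hdec]
  simp only [Option.map_some, Option.getD_some, value, ← hni m, step, Encodable.encodek]
  simp [List.getD, hlt]

/-- A family of countable unions of closed null sets, indexed by a well-order all of whose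
initial segments are of size less than `𝔟` and can be guessed infinitely often, is dominated
by an increasing one. -/
theorem exists_monotone_superset {ι : Type} [LinearOrder ι] [WellFoundedLT ι]
    (hguess : ∀ α : ι, GuessesInfinitelyOften (Iio α))
    (hb : ∀ α : ι, Cardinal.mk (Iio α) < boundingNumber)
    {S : ι → Set ℝ} (hS : ∀ α, IsFsigmaNull (S α)) :
    ∃ A : ι → Set ℝ, Monotone A ∧ (∀ α, IsFsigmaNull (A α)) ∧ ∀ α, S α ⊆ A α := by
  have hstep : ∀ α (prev : Iio α → Set ℝ), ∃ B : Set ℝ, (∀ β, IsFsigmaNull (prev β)) →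
      IsFsigmaNull B ∧ S α ⊆ B ∧ ∀ β, prev β ⊆ B := fun α prev => by
    by_cases hprev : ∀ β, IsFsigmaNull (prev β)
    · obtain ⟨B, hB, hsub⟩ := IsFsigmaNull.exists_superset (hguess α) (hb α) hprev
      exact ⟨S α ∪ B, fun _ => ⟨(hS α).union hB, subset_union_left,
        fun β => (hsub β).trans subset_union_right⟩⟩
    · exact ⟨∅, fun h => absurd h hprev⟩
  choose B hB using hstep
  let A : ι → Set ℝ := wellFounded_lt.fix fun α prev => B α fun β => prev β.1 β.2
  have hA : ∀ α, A α = B α fun β => A β.1 := fun α => wellFounded_lt.fix_eq _ α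
  have hAS : ∀ α, IsFsigmaNull (A α) := fun α => by
    induction α using WellFoundedLT.induction with
    | ind α ih => rw [hA]; exact (hB α _ fun β => ih β.1 β.2).1
  refine ⟨A, fun β α hβα => ?_, hAS, fun α => ?_⟩
  · rcases hβα.eq_or_lt with rfl | hlt
    · exact Subset.rfl
    · rw [hA α]
      exact (hB α _ fun γ => hAS γ.1).2.2 ⟨β, hlt⟩
  · rw [hA]
    exact (hB α _ fun β => hAS β.1).2.1

theorem exists_meagre_cover_mk_eq_covMeagre :
    ∃ F : Set (Set ℝ), Cardinal.mk F = covMeagre ∧ (∀ S ∈ F, IsMeagre S) ∧ ⋃₀ F = univ := by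
  refine csInf_mem (s := {c : Cardinal | ∃ F : Set (Set ℝ), Cardinal.mk F = c ∧
    (∀ S ∈ F, IsMeagre S) ∧ ⋃₀ F = univ}) ⟨_, range fun x : ℝ => {x}, rfl, ?_, ?_⟩
  · rintro _ ⟨x, rfl⟩
    exact residual_of_dense_open isOpen_compl_singleton (dense_compl_singleton x)
  · exact eq_univ_of_forall fun x => ⟨{x}, ⟨x, rfl⟩, rfl⟩

/-- If `cov(M) = 𝔟 = κ`, then there is a `⊆`-increasing κ-indexed family of sets,
each a countable union of closed Lebesgue-null sets, whose union is not Lebesgue-null. -/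
theorem covMeagre_eq_boundingNumber_implies_null_tower
    (h : covMeagre = boundingNumber) :
    ∃ A : {α : Ordinal // α < covMeagre.ord} → Set ℝ,
      (∀ α β : {α : Ordinal // α < covMeagre.ord}, α ≤ β → A α ⊆ A β) ∧
      (∀ α, ∃ C : ℕ → Set ℝ,
        (∀ n, IsClosed (C n) ∧ volume (C n) = 0) ∧ A α = ⋃ n, C n) ∧
      volume (⋃ α, A α) ≠ 0 := by
  have hlt : ∀ α : covMeagre.ord.ToType, Cardinal.mk (Iio α) < covMeagre :=
    fun α => by simpa using Cardinal.mk_Iio_lt α (by simp)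
  by_cases hnull : ∀ S : covMeagre.ord.ToType → Set ℝ,
      (∀ ξ, IsFsigmaNull (S ξ)) → volume (⋃ ξ, S ξ) = 0
  · obtain ⟨F, hF, hFM, hFu⟩ := exists_meagre_cover_mk_eq_covMeagre
    obtain ⟨e⟩ := Cardinal.eq.1 ((Cardinal.mk_ord_toType covMeagre).trans hF.symm)
    refine absurd ?_ ((guessesInfinitelyOften_of_null_iUnion hnull).iUnion_meagre_ne_univ
      (M := fun ξ => (e ξ : Set ℝ)) fun ξ => hFM _ (e ξ).2)
    rw [← hFu, sUnion_eq_iUnion]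
    exact e.surjective.iUnion_comp fun S : F => (S : Set ℝ)
  · push Not at hnull
    obtain ⟨S, hS, hne⟩ := hnull
    obtain ⟨A, hmono, hA, hSA⟩ := exists_monotone_superset
      (fun α => guessesInfinitelyOften_of_lt_covMeagre (hlt α)) (fun α => h ▸ hlt α) hS
    let φ : {α : Ordinal // α < covMeagre.ord} ≃o covMeagre.ord.ToType := Ordinal.ToType.mk
    refine ⟨fun α => A (φ α), fun α β hαβ => hmono (φ.monotone hαβ), fun α => hA _, ?_⟩
    rw [φ.surjective.iUnion_comp A]
    exact fun h0 => hne (measure_mono_null (iUnion_mono hSA) h0)
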